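/- arXiv:1904.02316 — 3 statements merged into one kernel-verified Lean document; each statement's English description precedes it below -/
import Mathlib

section
/- Let V be a real normed vector space with dual V*, A ⊆ V a closed convex set with interior A°, and φ : A → ℝ a mirror function with strong convexity modulus σ > 0 with respect to ‖·‖_V, differentiable on A°. Let G : A → ℝ be a convex function, y ∈ A°, s > 0, and suppose x = argmin_{z∈A} ( D_φ(z,y) + s·G(z) ). Then x ∈ A° and ∇φ(x) − ∇φ(y) ∈ −s·∂G(x), i.e. there exists h ∈ V* with G(z) ≥ G(x) + ⟨h, z − x⟩ for all z ∈ A and ∇φ(x) − ∇φ(y) = −s·h. -/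
open scoped BigOperators

/-- The subdifferential of a function `f` on a set `A` at a point `x`:
the set of continuous linear functionals `g` with `f z ≥ f x + g (z - x)` for all `z ∈ A`. -/
def subdiff {V : Type*} [NormedAddCommGroup V] [NormedSpace ℝ V]
    (A : Set V) (f : V → ℝ) (x : V) : Set (V →L[ℝ] ℝ) :=
  {g | ∀ z ∈ A, f x + g (z - x) ≤ f z}

/-- The Bregman distance associated to `φ` with gradient map `gradφ`. -/
def bregman {V : Type*} [NormedAddCommGroup V] [NormedSpace ℝ V]
    (φ : V → ℝ) (gradφ : V → (V →L[ℝ] ℝ)) (x y : V) : ℝ :=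
  φ x - φ y - gradφ y (x - y)

/-- `φ` is `σ`-strongly convex on `A` with respect to the norm. -/
def StrongConvexOnSet {V : Type*} [NormedAddCommGroup V] [NormedSpace ℝ V]
    (A : Set V) (σ : ℝ) (φ : V → ℝ) : Prop :=
  ∀ ⦃x⦄, x ∈ A → ∀ ⦃y⦄, y ∈ A → ∀ ⦃a b : ℝ⦄, 0 ≤ a → 0 ≤ b → a + b = 1 →
    φ (a • x + b • y) ≤ a * φ x + b * φ y - σ / 2 * a * b * ‖x - y‖ ^ 2

open Filter Topology in
/-- The gradient inequality for a strongly convex function, at a point of differentiability. -/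
lemma StrongConvexOnSet.add_apply_sub_add_le
    {V : Type*} [NormedAddCommGroup V] [NormedSpace ℝ V] {A : Set V} {σ : ℝ} {φ : V → ℝ}
    (hφ : StrongConvexOnSet A σ φ) {g : V →L[ℝ] ℝ} {u x : V} (hu : u ∈ A) (hx : x ∈ A)
    (hg : HasFDerivAt φ g u) :
    φ u + g (x - u) + σ / 2 * ‖x - u‖ ^ 2 ≤ φ x := by
  have hline : HasDerivAt (fun t : ℝ => φ (u + t • (x - u))) (g (x - u)) 0 := by
    have h1 : HasDerivAt (fun t : ℝ => u + t • (x - u)) (x - u) 0 := by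
      simpa using ((hasDerivAt_id (0 : ℝ)).smul_const (x - u)).const_add u
    exact HasFDerivAt.comp_hasDerivAt_of_eq (0 : ℝ) hg h1 (by simp)
  have hupper : Tendsto (fun t : ℝ => φ x - φ u - σ / 2 * (1 - t) * ‖x - u‖ ^ 2) (𝓝[>] 0)
      (𝓝 (φ x - φ u - σ / 2 * (1 - 0) * ‖x - u‖ ^ 2)) :=
    (Continuous.tendsto (by fun_prop) 0).mono_left nhdsWithin_le_nhds
  have hle := le_of_tendsto_of_tendsto hline.tendsto_slope_zero_right hupper (by
    filter_upwards [Ioo_mem_nhdsGT (zero_lt_one : (0 : ℝ) < 1)] with t ht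
    have hconv := hφ hx hu ht.1.le (sub_nonneg.2 ht.2.le) (by ring)
    have hpt : t • x + (1 - t) • u = u + t • (x - u) := by module
    rw [hpt] at hconv
    simp only [zero_add, zero_smul, add_zero, smul_eq_mul]
    rw [inv_mul_le_iff₀ ht.1]
    linarith)
  linarith

lemma StrongConvexOnSet.convexOn
    {V : Type*} [NormedAddCommGroup V] [NormedSpace ℝ V] {A : Set V} {σ : ℝ} {φ : V → ℝ}
    (hφ : StrongConvexOnSet A σ φ) (hσ : 0 ≤ σ) (hA : Convex ℝ A) : ConvexOn ℝ A φ := by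
  refine ⟨hA, fun x hx y hy a b ha hb hab => ?_⟩
  have h := hφ hx hy ha hb hab
  have : 0 ≤ σ / 2 * a * b * ‖x - y‖ ^ 2 := by positivity
  simp only [smul_eq_mul]
  linarith

/-- A convex function that dominates a concave function on `A`, and is continuous on the nonempty
interior of `A`, is separated from it by a continuous affine function. -/
lemma ConvexOn.exists_affine_between
    {V : Type*} [NormedAddCommGroup V] [NormedSpace ℝ V] {A : Set V} {f k : V → ℝ}
    (hf : ConvexOn ℝ A f) (hk : ConcaveOn ℝ A k) (hcont : ContinuousOn f (interior A))
    (hA : (interior A).Nonempty) (hkf : ∀ z ∈ A, k z ≤ f z) :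
    ∃ (p : V →L[ℝ] ℝ) (c : ℝ), (∀ z ∈ interior A, p z + c ≤ f z) ∧ ∀ z ∈ A, k z ≤ p z + c := by
  have hopen : IsOpen {w : V × ℝ | w.1 ∈ interior A ∧ f w.1 < w.2} := by
    rw [isOpen_iff_mem_nhds]
    rintro ⟨z, r⟩ ⟨hz, hr⟩
    have hfz : ContinuousAt (fun w : V × ℝ => f w.1) (z, r) :=
      ContinuousAt.comp (f := Prod.fst) (hcont.continuousAt (isOpen_interior.mem_nhds hz))
        continuousAt_fst
    filter_upwards [continuousAt_fst.preimage_mem_nhds (isOpen_interior.mem_nhds hz),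
      hfz.eventually_lt continuousAt_snd hr] with w hw hlt using ⟨hw, hlt⟩
  obtain ⟨l, v, hlt, hle⟩ := geometric_hahn_banach_open
    (hf.subset interior_subset hf.1.interior).convex_strict_epigraph hopen hk.convex_hypograph
    (Set.disjoint_left.2 fun w hw hw' => (hw'.2.trans (hkf _ hw'.1)).not_gt hw.2)
  set q : V →L[ℝ] ℝ := l.comp (ContinuousLinearMap.inl ℝ V ℝ)
  set β : ℝ := l (0, 1)
  have hl (z : V) (r : ℝ) : l (z, r) = q z + r * β := by
    have : (z, r) = ContinuousLinearMap.inl ℝ V ℝ z + r • ((0, 1) : V × ℝ) := by simp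
    rw [this, map_add, map_smul]
    rfl
  have hlt' (z : V) (hz : z ∈ interior A) (r : ℝ) (hr : f z < r) : q z + r * β < v :=
    hl z r ▸ hlt (z, r) ⟨hz, hr⟩
  have hle' (z : V) (hz : z ∈ A) : v ≤ q z + k z * β := hl z (k z) ▸ hle (z, k z) ⟨hz, le_rfl⟩
  have hβ : β < 0 := by
    obtain ⟨y, hy⟩ := hA
    have h1 := hlt' y hy (f y + 1) (by linarith)
    have h2 := hle' y (interior_subset hy)
    have h3 := hkf y (interior_subset hy)
    nlinarith
  refine ⟨(-β⁻¹) • q, v * β⁻¹, fun z hz => ?_, fun z hz => ?_⟩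
  · refine le_of_forall_gt_imp_ge_of_dense fun r hr => ?_
    have h := mul_le_mul_of_nonpos_right (hlt' z hz r hr).le (inv_lt_zero.2 hβ).le
    rw [add_mul, mul_assoc, mul_inv_cancel₀ hβ.ne] at h
    simp only [smul_apply, smul_eq_mul]
    linarith
  · have h := mul_le_mul_of_nonpos_right (hle' z hz) (inv_lt_zero.2 hβ).le
    rw [add_mul, mul_assoc, mul_inv_cancel₀ hβ.ne] at h
    simp only [smul_apply, smul_eq_mul]
    linarith

/-- Lemma 1: the mirror-prox (backward) step lands in the interior and satisfies
`∇φ(x) − ∇φ(y) ∈ −s·∂G(x)`. -/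
theorem mirror_prox_optimality
    {V : Type*} [NormedAddCommGroup V] [NormedSpace ℝ V]
    (A : Set V) (hAcl : IsClosed A) (hAconv : Convex ℝ A)
    (φ : V → ℝ) (gradφ : V → (V →L[ℝ] ℝ)) (σ : ℝ) (hσ : 0 < σ)
    (hφsc : StrongConvexOnSet A σ φ)
    (hφdiff : ∀ x ∈ interior A, HasFDerivAt φ (gradφ x) x)
    (hφbij : Set.BijOn gradφ (interior A) (Set.univ : Set (V →L[ℝ] ℝ)))
    (G : V → ℝ) (hG : ConvexOn ℝ A G)
    (y : V) (hy : y ∈ interior A) (s : ℝ) (hs : 0 < s)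
    (x : V) (hxA : x ∈ A)
    (hxmin : ∀ z ∈ A, bregman φ gradφ x y + s * G x ≤ bregman φ gradφ z y + s * G z) :
    x ∈ interior A ∧ ∃ h ∈ subdiff A G x, gradφ x - gradφ y = -(s • h) := by
  have hk : ConcaveOn ℝ A fun z => φ x + gradφ y (z - x) - s * (G z - G x) := by
    refine ⟨hAconv, fun z hz w hw a b ha hb hab => ?_⟩
    have h := mul_le_mul_of_nonneg_left (hG.2 hz hw ha hb hab) hs.le
    obtain rfl : b = 1 - a := by linarith
    simp only [map_sub, map_add, map_smul, smul_eq_mul] at h ⊢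
    linarith
  obtain ⟨p, c, hp, hkp⟩ := (hφsc.convexOn hσ.le hAconv).exists_affine_between hk
    (fun z hz => (hφdiff z hz).continuousAt.continuousWithinAt) ⟨y, hy⟩ (fun z hz => by
      have h := hxmin z hz
      simp only [bregman, map_sub] at h ⊢
      linarith)
  obtain ⟨u, hu, rfl⟩ := hφbij.surjOn (Set.mem_univ p)
  have hx : φ x ≤ gradφ u x + c := by simpa using hkp x hxA
  have hux : x = u := by
    have h1 := hφsc.add_apply_sub_add_le (interior_subset hu) hxA (hφdiff u hu)
    have h2 := hp u hu
    rw [map_sub] at h1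
    have h3 : ‖x - u‖ ^ 2 ≤ 0 := by nlinarith
    exact sub_eq_zero.1 (norm_eq_zero.1 (pow_eq_zero_iff two_ne_zero |>.1
      (h3.antisymm (sq_nonneg _))))
  subst hux
  refine ⟨hu, s⁻¹ • (gradφ y - gradφ x), fun z hz => ?_, ?_⟩
  · have h1 := hkp z hz
    have h2 := hp x hu
    have h3 : s⁻¹ * (gradφ y (z - x) - gradφ x (z - x)) ≤ G z - G x := by
      rw [inv_mul_le_iff₀ hs, map_sub (gradφ x)]
      linarith
    simp only [smul_apply, sub_apply, smul_eq_mul]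
    linarith
  · rw [smul_inv_smul₀ hs.ne', neg_sub]
end

section
/- Let V be a real normed vector space with dual V*, A ⊆ V a closed convex set with interior A°, and φ : A → ℝ a mirror function with strong convexity modulus σ > 0, differentiable on A°. Let y ∈ A°, w ∈ V*, s > 0, and suppose x = argmin_{z∈A} ( D_φ(z,y) + ⟨s·w, z⟩ ). Then x ∈ A° and ∇φ(x) − ∇φ(y) = −s·w. -/
open scoped BigOperators

/-- First-order lower bound for a strongly convex function at a point of differentiability. -/
theorem StrongConvexOnSet.fderiv_add_sq_le
    {V : Type*} [NormedAddCommGroup V] [NormedSpace ℝ V]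
    {A : Set V} {σ : ℝ} {φ : V → ℝ} (hφ : StrongConvexOnSet A σ φ)
    {x z : V} (hx : x ∈ A) (hz : z ∈ A) {L : V →L[ℝ] ℝ} (hL : HasFDerivAt φ L z) :
    L (x - z) + σ / 2 * ‖x - z‖ ^ 2 ≤ φ x - φ z := by
  have hslope := (hL.hasLineDerivAt (x - z)).tendsto_slope_zero_right
  have hbound : Filter.Tendsto (fun t : ℝ => φ x - φ z - σ / 2 * (1 - t) * ‖x - z‖ ^ 2)
      (nhdsWithin 0 (Set.Ioi 0)) (nhds (φ x - φ z - σ / 2 * (1 - 0) * ‖x - z‖ ^ 2)) :=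
    (Continuous.tendsto (by fun_prop) 0).mono_left nhdsWithin_le_nhds
  have hle := le_of_tendsto_of_tendsto hslope hbound (by
    filter_upwards [Ioo_mem_nhdsGT (zero_lt_one (α := ℝ))] with t ht
    have h := hφ hx hz ht.1.le (sub_nonneg.2 ht.2.le) (add_sub_cancel t 1)
    have hseg : t • x + (1 - t) • z = z + t • (x - z) := by module
    rw [hseg] at h
    rw [smul_eq_mul, inv_mul_le_iff₀ ht.1]
    linarith)
  linarith

/-- Corollary 1: the mirror (forward) step with a linear objective
lands in the interior and satisfies `∇φ(x) − ∇φ(y) = −s·w`. -/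
theorem mirror_forward_optimality
    {V : Type*} [NormedAddCommGroup V] [NormedSpace ℝ V]
    (A : Set V) (hAcl : IsClosed A) (hAconv : Convex ℝ A)
    (φ : V → ℝ) (gradφ : V → (V →L[ℝ] ℝ)) (σ : ℝ) (hσ : 0 < σ)
    (hφsc : StrongConvexOnSet A σ φ)
    (hφdiff : ∀ x ∈ interior A, HasFDerivAt φ (gradφ x) x)
    (hφbij : Set.BijOn gradφ (interior A) (Set.univ : Set (V →L[ℝ] ℝ)))
    (y : V) (hy : y ∈ interior A) (w : V →L[ℝ] ℝ) (s : ℝ) (hs : 0 < s)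
    (x : V) (hxA : x ∈ A)
    (hxmin : ∀ z ∈ A, bregman φ gradφ x y + (s • w) x ≤ bregman φ gradφ z y + (s • w) z) :
    x ∈ interior A ∧ gradφ x - gradφ y = -(s • w) := by
  obtain ⟨z, hz, hgrad⟩ := hφbij.surjOn (Set.mem_univ (gradφ y - s • w))
  have hlower := hφsc.fderiv_add_sq_le hxA (interior_subset hz) (hφdiff z hz)
  have hmin := hxmin z (interior_subset hz)
  simp only [bregman, hgrad, map_sub, sub_apply] at hlower hmin
  have hsq : σ / 2 * ‖x - z‖ ^ 2 ≤ 0 := by linarith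
  have hnorm : ‖x - z‖ ^ 2 ≤ 0 := nonpos_of_mul_nonpos_right hsq (half_pos hσ)
  have hxz : x = z := by
    rw [← sub_eq_zero, ← norm_eq_zero]
    exact pow_eq_zero_iff two_ne_zero |>.1 (le_antisymm hnorm (sq_nonneg _))
  subst hxz
  exact ⟨hz, by rw [hgrad]; abel⟩
end

section
/- Let V be a real normed vector space with dual V*, A ⊆ V a closed convex set with interior A°, and φ : A → ℝ a mirror function with strong convexity modulus σ > 0, differentiable on A°. Let G : A → ℝ be convex, let w_1, …, w_n ∈ V*, let s_i, t_i ≥ 0, α_{n+1} > 0, γ_{n+1} > 0, x_1 ∈ A°, and suppose x_{n+1} = argmin_{x∈A} ( Σ_{i=1}^n ⟨s_i w_i, x⟩ + α_{n+1} D_φ(x, x_1) + γ_{n+1} G(x) ). Then x_{n+1} ∈ A° and there exists h_{n+1} ∈ ∂G(x_{n+1}) satisfying the first-order optimality condition α_{n+1}( ∇φ(x_{n+1}) − ∇φ(x_1) ) + γ_{n+1} h_{n+1} + Σ_{i=1}^n s_i w_i = 0. -/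
open scoped BigOperators

open Set Filter Topology

section

variable {V : Type*} [NormedAddCommGroup V] [NormedSpace ℝ V]

/-- A bound on the increments of `f` along a ray bounds its directional derivative. -/
theorem HasFDerivAt.apply_le_of_forall_sub_le {f : V → ℝ} {f' : V →L[ℝ] ℝ} {y d : V}
    (hf : HasFDerivAt f f' y) {c k : ℝ}
    (h : ∀ t : ℝ, 0 < t → t < 1 → f (y + t • d) - f y ≤ t * (c + t * k)) : f' d ≤ c := by
  have hslope := (hf.hasLineDerivAt d).tendsto_slope_zero_right
  have hlim : Tendsto (fun t : ℝ => c + t * k) (𝓝[>] 0) (𝓝 c) := by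
    have : Tendsto (fun t : ℝ => c + t * k) (𝓝 0) (𝓝 (c + 0 * k)) :=
      Continuous.tendsto (by fun_prop) 0
    rw [zero_mul, add_zero] at this
    exact this.mono_left nhdsWithin_le_nhds
  refine le_of_tendsto_of_tendsto hslope hlim ?_
  filter_upwards [Ioo_mem_nhdsGT (zero_lt_one' ℝ)] with t ht
  rw [smul_eq_mul, inv_mul_le_iff₀ ht.1]
  simpa using h t ht.1 ht.2

namespace StrongConvexOnSet

variable {A : Set V} {σ : ℝ} {φ : V → ℝ}

theorem convexOn_s4 (hφ : StrongConvexOnSet A σ φ) (hσ : 0 ≤ σ) (hA : Convex ℝ A) :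
    ConvexOn ℝ A φ := by
  refine ⟨hA, fun x hx y hy a b ha hb hab => ?_⟩
  have h := hφ hx hy ha hb hab
  have : 0 ≤ σ / 2 * a * b * ‖x - y‖ ^ 2 := by positivity
  simp only [smul_eq_mul]
  linarith

theorem add_sq_norm_le (hφ : StrongConvexOnSet A σ φ) {y z : V} (hy : y ∈ A) (hz : z ∈ A)
    {g : V →L[ℝ] ℝ} (hg : HasFDerivAt φ g y) :
    φ y + g (z - y) + σ / 2 * ‖z - y‖ ^ 2 ≤ φ z := by
  have := hg.apply_le_of_forall_sub_le (d := z - y)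
    (c := φ z - φ y - σ / 2 * ‖z - y‖ ^ 2) (k := σ / 2 * ‖z - y‖ ^ 2) fun t h0 h1 => by
      have h := hφ hz hy h0.le (sub_nonneg.2 h1.le) (add_sub_cancel t 1)
      rw [show t • z + (1 - t) • y = y + t • (z - y) by module] at h
      linarith
  linarith

end StrongConvexOnSet

/-- A convex function whose decrease along a segment from `x` into the interior of its domain is at
most linear has a supporting hyperplane at `x`, as seen from the interior. -/
theorem ConvexOn.exists_supporting_of_linear_decrease {A : Set V} {φ : V → ℝ}
    (hφ : ConvexOn ℝ A φ) (hcont : ContinuousOn φ (interior A)) {x x₁ : V}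
    (hx₁ : x₁ ∈ interior A) {M : ℝ}
    (hM : ∀ t : ℝ, 0 ≤ t → t ≤ 1 → φ x - t * M ≤ φ (x + t • (x₁ - x))) :
    ∃ g : V →L[ℝ] ℝ, ∀ z ∈ interior A, φ x + g (z - x) ≤ φ z := by
  let E : Set (V × ℝ) := {p | p.1 ∈ interior A ∧ φ p.1 < p.2}
  let S : Set (V × ℝ) := segment ℝ (x, φ x) (x₁, φ x - M)
  have hE : Convex ℝ E := (hφ.subset interior_subset hφ.1.interior).convex_strict_epigraph
  have hEo : IsOpen E := by
    have hc : ContinuousOn (fun p : V × ℝ => p.2 - φ p.1) (interior A ×ˢ univ) :=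
      continuousOn_snd.sub (hcont.comp continuousOn_fst fun p hp => hp.1)
    convert hc.isOpen_inter_preimage (isOpen_interior.prod isOpen_univ)
      (isOpen_Ioi (a := (0 : ℝ))) using 1
    ext p
    simp [E]
  have hdisj : Disjoint E S := by
    rw [Set.disjoint_left]
    rintro p ⟨-, hp⟩ hpS
    rw [show S = _ from segment_eq_image' ℝ _ _] at hpS
    obtain ⟨t, ht, rfl⟩ := hpS
    have := hM t ht.1 ht.2
    simp only [Prod.fst_add, Prod.snd_add, Prod.smul_fst, Prod.smul_snd, Prod.fst_sub,
      Prod.snd_sub, smul_eq_mul] at hp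
    linarith
  obtain ⟨f, u, hfE, hfS⟩ := geometric_hahn_banach_open hE hEo (convex_segment _ _) hdisj
  have hsplit (z : V) (r : ℝ) : f (z, r) = f (z, 0) + r * f (0, 1) := by
    rw [← smul_eq_mul, ← map_smul, ← map_add]
    simp
  set c := f (0, 1)
  have hc_neg : c < 0 := by
    have h1 := hfE (x₁, φ x₁ + 1) ⟨hx₁, by simp⟩
    have h2 := hfS _ (right_mem_segment ℝ (x, φ x) (x₁, φ x - M))
    have h3 := hM 1 zero_le_one le_rfl
    rw [one_smul, add_sub_cancel] at h3
    rw [hsplit] at h1 h2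
    by_contra! hc0
    nlinarith
  refine ⟨(-c)⁻¹ • f.comp (ContinuousLinearMap.inl ℝ V ℝ), fun z hz => ?_⟩
  have hx := hfS _ (left_mem_segment ℝ (x, φ x) (x₁, φ x - M))
  rw [hsplit] at hx
  have hfsub : f (z - x, 0) = f (z, 0) - f (x, 0) := by
    rw [← map_sub]
    simp
  refine le_of_forall_gt_imp_ge_of_dense fun r hr => ?_
  have h := hfE (z, r) ⟨hz, hr⟩
  rw [hsplit] at h
  simp only [FunLike.coe_smul, Pi.smul_apply, ContinuousLinearMap.comp_apply,
    ContinuousLinearMap.inl_apply, smul_eq_mul, hfsub]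
  rw [← le_sub_iff_add_le', inv_mul_le_iff₀ (neg_pos.2 hc_neg)]
  linarith

end

/-- First-order optimality for the XRDA subproblem: the minimizer `x_{n+1}` of
`Σᵢ ⟨sᵢwᵢ, x⟩ + α_{n+1} D_φ(x, x₁) + γ_{n+1} G(x)` over `A` lies in the interior of `A`
and there is `h_{n+1} ∈ ∂G(x_{n+1})` with
`α_{n+1}(∇φ(x_{n+1}) − ∇φ(x₁)) + γ_{n+1} h_{n+1} + Σᵢ sᵢwᵢ = 0`. -/
theorem xrda_subproblem_optimality
    {V : Type*} [NormedAddCommGroup V] [NormedSpace ℝ V]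
    (A : Set V) (hAcl : IsClosed A) (hAconv : Convex ℝ A)
    (φ : V → ℝ) (gradφ : V → (V →L[ℝ] ℝ)) (σ : ℝ) (hσ : 0 < σ)
    (hφsc : StrongConvexOnSet A σ φ)
    (hφdiff : ∀ x ∈ interior A, HasFDerivAt φ (gradφ x) x)
    (hφbij : Set.BijOn gradφ (interior A) (Set.univ : Set (V →L[ℝ] ℝ)))
    (G : V → ℝ) (hG : ConvexOn ℝ A G)
    (n : ℕ) (w : Fin n → (V →L[ℝ] ℝ)) (s t : Fin n → ℝ)
    (hs : ∀ i, 0 ≤ s i) (ht : ∀ i, 0 ≤ t i)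
    (α γ : ℝ) (hα : 0 < α) (hγ : 0 < γ)
    (x₁ : V) (hx₁ : x₁ ∈ interior A)
    (xnext : V) (hxnextA : xnext ∈ A)
    (hxnextmin : ∀ z ∈ A,
      (∑ i, s i • w i) xnext + α * bregman φ gradφ xnext x₁ + γ * G xnext
        ≤ (∑ i, s i • w i) z + α * bregman φ gradφ z x₁ + γ * G z) :
    xnext ∈ interior A ∧ ∃ hnext ∈ subdiff A G xnext,
      α • (gradφ xnext - gradφ x₁) + γ • hnext + ∑ i, s i • w i = 0 := by
  have hφconv := hφsc.convexOn_s4 hσ.le hAconv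
  set ℓ : V →L[ℝ] ℝ := ∑ i, s i • w i
  have hmin {z : V} (hz : z ∈ A) {t : ℝ} (h0 : 0 ≤ t) (h1 : t ≤ 1) :
      0 ≤ α * (φ (xnext + t • (z - xnext)) - φ xnext)
        + t * (ℓ (z - xnext) - α * gradφ x₁ (z - xnext) + γ * (G z - G xnext)) := by
    have heq : t • z + (1 - t) • xnext = xnext + t • (z - xnext) := by module
    have hmem := hAconv hz hxnextA h0 (sub_nonneg.2 h1) (add_sub_cancel t 1)
    have hGt := hG.2 hz hxnextA h0 (sub_nonneg.2 h1) (add_sub_cancel t 1)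
    rw [heq] at hmem hGt
    have h := hxnextmin _ hmem
    simp only [bregman, map_sub, map_add, map_smul, smul_eq_mul] at h hGt ⊢
    linarith [mul_le_mul_of_nonneg_left hGt hγ.le]
  have hint : xnext ∈ interior A := by
    obtain ⟨g, hg⟩ := hφconv.exists_supporting_of_linear_decrease
      (fun x hx => (hφdiff x hx).continuousAt.continuousWithinAt) hx₁ (x := xnext)
      (M := (ℓ (x₁ - xnext) - α * gradφ x₁ (x₁ - xnext) + γ * (G x₁ - G xnext)) / α)
      fun t h0 h1 => by
        have h := hmin (interior_subset hx₁) h0 h1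
        rw [← mul_div_assoc, sub_le_iff_le_add, ← sub_le_iff_le_add', le_div_iff₀ hα]
        linarith
    obtain ⟨y, hy, rfl⟩ := hφbij.surjOn (mem_univ g)
    have h1 := hg y hy
    have h2 := hφsc.add_sq_norm_le (interior_subset hy) hxnextA (hφdiff y hy)
    rw [← neg_sub y xnext, map_neg, norm_neg] at h2
    have h3 : ‖y - xnext‖ = 0 := by
      by_contra hne
      have : 0 < σ / 2 * ‖y - xnext‖ ^ 2 := by positivity
      linarith
    rwa [← sub_eq_zero.1 (norm_eq_zero.1 h3)]
  refine ⟨hint, -(γ⁻¹ • (α • (gradφ xnext - gradφ x₁) + ℓ)), fun z hz => ?_, ?_⟩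
  · have h := ((hφdiff xnext hint).const_mul (-α)).apply_le_of_forall_sub_le (d := z - xnext)
      (c := ℓ (z - xnext) - α * gradφ x₁ (z - xnext) + γ * (G z - G xnext)) (k := 0)
      fun t h0 h1 => by linarith [hmin hz h0.le h1.le]
    simp only [FunLike.coe_smul, FunLike.coe_add, FunLike.coe_sub, FunLike.coe_neg,
      Pi.smul_apply, Pi.add_apply, Pi.sub_apply, Pi.neg_apply, smul_eq_mul] at h ⊢
    rw [← le_sub_iff_add_le', ← mul_neg, inv_mul_le_iff₀ hγ]
    linarith
  · rw [smul_neg, smul_inv_smul₀ hγ.ne']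
    abel
end
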